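/- Every minimal three-dimensional lattice polytope P is either a minimal 1-point polytope (i.e. has exactly one interior lattice point) or a non-hollow tetrahedron whose interior lattice points all lie on a common line. -/

import Mathlib

open Set MeasureTheory

noncomputable section

/-- The canonical embedding of lattice points `ℤ^d` into `ℝ^d`. -/
def castPt {d : ℕ} (v : Fin d → ℤ) : Fin d → ℝ := fun i => (v i : ℝ)

/-- A lattice polytope: the convex hull of a nonempty finite set of lattice points. -/
def IsLatticePolytope {d : ℕ} (P : Set (Fin d → ℝ)) : Prop :=
  ∃ V : Finset (Fin d → ℤ), V.Nonempty ∧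
    P = convexHull ℝ (castPt '' (V : Set (Fin d → ℤ)))

/-- The interior lattice points of a full-dimensional polytope `P`. -/
def intLatPts {d : ℕ} (P : Set (Fin d → ℝ)) : Set (Fin d → ℤ) :=
  {x | castPt x ∈ interior P}

/-- Unimodular equivalence: an affine lattice automorphism in `GL_d(ℤ) ⋉ ℤ^d` maps `P` onto `Q`. -/
def UnimodEquiv {d : ℕ} (P Q : Set (Fin d → ℝ)) : Prop :=
  ∃ (A : Matrix (Fin d) (Fin d) ℤ) (b : Fin d → ℤ), IsUnit A.det ∧
    (fun x : Fin d → ℝ => (A.map (Int.cast : ℤ → ℝ)).mulVec x + castPt b) '' P = Q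

/-- A three-dimensional lattice polytope with exactly `k` interior lattice points. -/
def IsKPoint3Polytope (k : ℕ) (P : Set (Fin 3 → ℝ)) : Prop :=
  IsLatticePolytope P ∧ affineSpan ℝ P = ⊤ ∧ (intLatPts P).ncard = k

/-- The polytopes satisfying `Q` form exactly `n` unimodular equivalence classes: there are
`n` representatives and every polytope satisfying `Q` is equivalent to exactly one of them. -/
def HasNClassesUpToEquiv (Q : Set (Fin 3 → ℝ) → Prop) (n : ℕ) : Prop :=
  ∃ S : Finset (Set (Fin 3 → ℝ)), S.card = n ∧ (∀ P ∈ S, Q P) ∧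
    ∀ P, Q P → ∃! R, R ∈ S ∧ UnimodEquiv P R

/-- The lattice points of `P`. -/
def latticePts {d : ℕ} (P : Set (Fin d → ℝ)) : Set (Fin d → ℤ) :=
  {x | castPt x ∈ P}

/-- The lattice points in the relative interior of `P`. -/
def relIntLatPts {d : ℕ} (P : Set (Fin d → ℝ)) : Set (Fin d → ℤ) :=
  {x | castPt x ∈ intrinsicInterior ℝ P}

/-- `P` is a minimal lattice polytope: `P` is not hollow, and for every vertex `v` of `P`
the polytope `conv((P ∩ ℤ^d) \ {v})` is hollow. -/
def IsMinimalPolytope {d : ℕ} (P : Set (Fin d → ℝ)) : Prop :=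
  (relIntLatPts P).Nonempty ∧
  ∀ v : Fin d → ℤ, castPt v ∈ Set.extremePoints ℝ P →
    relIntLatPts (convexHull ℝ (castPt '' (latticePts P \ {v}))) = ∅

/-- A lattice tetrahedron: the convex hull of four affinely independent lattice points. -/
def IsLatticeTetrahedron (P : Set (Fin 3 → ℝ)) : Prop :=
  ∃ v : Fin 4 → Fin 3 → ℤ, AffineIndependent ℝ (fun i => castPt (v i)) ∧
    P = convexHull ℝ (Set.range fun i => castPt (v i))

/-- `S` surrounds `p`: no nonzero functional is nonpositive on `S - p`. -/
def Surr {n : ℕ} (S : Set (Fin n → ℝ)) (p : Fin n → ℝ) : Prop :=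
  ∀ f : (Fin n → ℝ) →ₗ[ℝ] ℝ, f ≠ 0 → ∃ x ∈ S, 0 < f (x - p)

theorem Surr.of_mem_interior {n : ℕ} {S : Set (Fin n → ℝ)} {p : Fin n → ℝ}
    (h : p ∈ interior (convexHull ℝ S)) : Surr S p := by
  intro f hf
  by_contra hcon
  push Not at hcon
  have hle : ∀ x ∈ convexHull ℝ S, f x ≤ f p := by
    intro x hx
    have : convexHull ℝ S ⊆ {w | f w ≤ f p} := by
      apply convexHull_min
      · intro y hy
        have := hcon y hy
        rw [map_sub] at this
        simp only [Set.mem_ofPred_eq]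
        linarith
      · exact convex_halfSpace_le f.isLinear _
    exact this hx
  apply hf
  have key : ∀ u : Fin n → ℝ, f u ≤ 0 := by
    intro u
    have hc : Filter.Tendsto (fun t : ℝ => p + t • u) (nhdsWithin 0 (Set.Ioi 0)) (nhds p) := by
      have : Continuous (fun t : ℝ => p + t • u) := by fun_prop
      have h2 := this.tendsto 0
      simp only [zero_smul, add_zero] at h2
      exact h2.mono_left nhdsWithin_le_nhds
    have hm : convexHull ℝ S ∈ nhds p := mem_interior_iff_mem_nhds.1 h
    obtain ⟨t, ht, ht0⟩ := ((hc.eventually hm).and self_mem_nhdsWithin).exists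
    have := hle _ ht
    simp only [map_add, map_smul, smul_eq_mul] at this
    have ht0 : 0 < t := ht0
    by_contra hh
    push Not at hh
    nlinarith [mul_pos ht0 hh]
  apply LinearMap.ext
  intro u
  have h1 := key u
  have h2 := key (-u)
  rw [map_neg] at h2
  rw [LinearMap.zero_apply]
  linarith

theorem Surr.vectorSpan_eq_top {n : ℕ} {S : Set (Fin n → ℝ)} {p : Fin n → ℝ}
    (h : Surr S p) (hne : S.Nonempty) : vectorSpan ℝ S = ⊤ := by
  by_contra hcon
  obtain ⟨f, hf, hker⟩ := Submodule.exists_le_ker_of_lt_top _ (lt_top_iff_ne_top.2 hcon)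
  obtain ⟨x0, hx0⟩ := hne
  have hconst : ∀ x ∈ S, f x = f x0 := by
    intro x hx
    have := hker (vsub_mem_vectorSpan ℝ hx hx0)
    simp only [vsub_eq_sub, LinearMap.mem_ker, map_sub] at this
    linarith
  obtain ⟨x, hx, h1⟩ := h f hf
  obtain ⟨y, hy, h2⟩ := h (-f) (neg_ne_zero.2 hf)
  simp only [LinearMap.neg_apply, map_sub, hconst x hx, hconst y hy] at h1 h2
  linarith

theorem Surr.mem_interior {n : ℕ} {S : Set (Fin n → ℝ)} {p : Fin n → ℝ}
    (h : Surr S p) (hne : S.Nonempty) : p ∈ interior (convexHull ℝ S) := by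
  by_contra hcon
  have hspan : affineSpan ℝ S = ⊤ :=
    (AffineSubspace.affineSpan_eq_top_iff_vectorSpan_eq_top_of_nonempty ℝ _ _ hne).2
      (h.vectorSpan_eq_top hne)
  have hint := interior_convexHull_nonempty_iff_affineSpan_eq_top.2 hspan
  have hcv : Convex ℝ (convexHull ℝ S) := convex_convexHull ℝ S
  obtain ⟨f, hf⟩ := geometric_hahn_banach_open_point hcv.interior isOpen_interior hcon
  have hf0 : (f : (Fin n → ℝ) →ₗ[ℝ] ℝ) ≠ 0 := by
    intro h0
    obtain ⟨y, hy⟩ := hint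
    have h1 := hf y hy
    have h2 : ∀ z, f z = 0 := fun z => by
      have := LinearMap.congr_fun h0 z
      simpa using this
    rw [h2, h2] at h1
    exact lt_irrefl _ h1
  obtain ⟨x, hx, hpos⟩ := h f hf0
  have hxc : x ∈ closure (interior (convexHull ℝ S)) := by
    rw [hcv.closure_interior_eq_closure_of_nonempty_interior hint]
    exact subset_closure (subset_convexHull ℝ S hx)
  have : closure (interior (convexHull ℝ S)) ⊆ {w | f w ≤ f p} :=
    closure_minimal (fun y hy => (hf y hy).le) (isClosed_le f.continuous continuous_const)
  have := this hxc
  simp only [Set.mem_ofPred_eq] at this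
  simp only [ContinuousLinearMap.coe_coe, map_sub] at hpos
  linarith

/-- Conic Carathéodory. -/
theorem conic_caratheodory {ι W : Type*} [DecidableEq ι] [AddCommGroup W] [Module ℝ W]
    (φ : ι → W) (S : Finset ι) (c : ι → ℝ) (hc : ∀ i ∈ S, 0 ≤ c i) :
    ∃ T ⊆ S, ∃ c' : ι → ℝ, (∀ i ∈ T, 0 < c' i) ∧ ∑ i ∈ T, c' i • φ i = ∑ i ∈ S, c i • φ i ∧
      LinearIndependent ℝ (fun i : T => φ i) := by
  induction hn : S.card using Nat.strong_induction_on generalizing S c with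
  | _ n ih =>
    by_cases hz : ∃ i ∈ S, c i = 0
    · obtain ⟨i, hi, h0⟩ := hz
      obtain ⟨T, hT, c', h1, h2, h3⟩ := ih _ (by
        rw [← hn]; exact Finset.card_erase_lt_of_mem hi) (S.erase i) c
        (fun j hj => hc j (Finset.mem_of_mem_erase hj)) rfl
      refine ⟨T, hT.trans (Finset.erase_subset _ _), c', h1, ?_, h3⟩
      rw [h2, ← Finset.add_sum_erase S _ hi, h0, zero_smul, zero_add]
    push Not at hz
    by_cases hli : LinearIndependent ℝ (fun i : S => φ i)
    · exact ⟨S, subset_rfl, c, fun i hi => lt_of_le_of_ne (hc i hi) (hz i hi).symm, rfl, hli⟩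
    have : ∃ g : ι → ℝ, ∑ i ∈ S, g i • φ i = 0 ∧ ∃ i ∈ S, 0 < g i := by
      rw [Fintype.not_linearIndependent_iff] at hli
      obtain ⟨g, hg, i, hi⟩ := hli
      have hg' : ∑ i ∈ S, (if h : i ∈ S then g ⟨i, h⟩ else 0) • φ i = 0 := by
        rw [← Finset.sum_coe_sort]
        simpa using hg
      rcases lt_or_gt_of_ne hi with h | h
      · refine ⟨fun i => -(if h : i ∈ S then g ⟨i, h⟩ else 0), ?_, i, i.2, by simpa using h⟩
        simp only [neg_smul, Finset.sum_neg_distrib, hg', neg_zero]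
      · exact ⟨_, hg', i, i.2, by simpa using h⟩
    obtain ⟨g, hg, i0, hi0, hgi0⟩ := this
    obtain ⟨t, ht, hmin⟩ := Finset.exists_min_image (S.filter (fun i => 0 < g i))
      (fun i => c i / g i) ⟨i0, by simp [hi0, hgi0]⟩
    simp only [Finset.mem_filter] at ht hmin
    set r := c t / g t with hr
    have hr0 : 0 ≤ r := div_nonneg (hc t ht.1) ht.2.le
    have hnn : ∀ j ∈ S, 0 ≤ c j - r * g j := by
      intro j hj
      by_cases hgj : 0 < g j
      · have := hmin j ⟨hj, hgj⟩
        rw [le_div_iff₀ hgj] at this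
        linarith
      · have := hc j hj
        push Not at hgj
        nlinarith [mul_nonneg hr0 (neg_nonneg.2 hgj)]
    obtain ⟨T, hT, c', h1, h2, h3⟩ := ih _ (by
      rw [← hn]; exact Finset.card_erase_lt_of_mem ht.1) (S.erase t) (fun j => c j - r * g j)
      (fun j hj => hnn j (Finset.mem_of_mem_erase hj)) rfl
    refine ⟨T, hT.trans (Finset.erase_subset _ _), c', h1, ?_, h3⟩
    have e1 : ∑ i ∈ S, (c i - r * g i) • φ i = ∑ i ∈ S, c i • φ i := by
      simp only [sub_smul, Finset.sum_sub_distrib, mul_smul, ← Finset.smul_sum, hg, smul_zero,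
        sub_zero]
    rw [h2, ← e1, ← Finset.add_sum_erase S _ ht.1]
    have : c t - r * g t = 0 := by
      rw [hr, div_mul_cancel₀ _ ht.2.ne', sub_self]
    rw [this, zero_smul, zero_add]

theorem Surr.mono {n : ℕ} {S T : Set (Fin n → ℝ)} {p : Fin n → ℝ} (h : Surr S p)
    (hST : S ⊆ T) : Surr T p := fun f hf =>
  let ⟨x, hx, h'⟩ := h f hf
  ⟨x, hST hx, h'⟩

theorem Surr.exists_cone {ι : Type*} {n : ℕ} {φ : ι → Fin n → ℝ} {S : Finset ι}
    (h : Surr (φ '' (S : Set ι)) 0) (hne : S.Nonempty) (w : Fin n → ℝ) :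
    ∃ c : ι → ℝ, (∀ i ∈ S, 0 ≤ c i) ∧ ∑ i ∈ S, c i • φ i = w := by
  classical
  have hint := h.mem_interior (by simpa using hne)
  have hsub : convexHull ℝ (φ '' (S : Set ι)) ⊆
      {y | ∃ c : ι → ℝ, (∀ i ∈ S, 0 ≤ c i) ∧ ∑ i ∈ S, c i • φ i = y} := by
    apply convexHull_min
    · rintro _ ⟨i, hi, rfl⟩
      refine ⟨Pi.single i 1, ?_, ?_⟩
      · intro j _
        by_cases hj : j = i
        · subst hj; simp
        · simp [hj]
      · rw [Finset.sum_eq_single i]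
        · simp
        · intro j _ hj; simp [hj]
        · intro hh; exact absurd hi hh
    · rintro x ⟨c, hc, rfl⟩ y ⟨d, hd, rfl⟩ a b ha hb _
      refine ⟨fun i => a * c i + b * d i, ?_, ?_⟩
      · intro i hi
        have := hc i hi
        have := hd i hi
        positivity
      · simp only [add_smul, mul_smul, Finset.sum_add_distrib, ← Finset.smul_sum]
  have hc : Filter.Tendsto (fun t : ℝ => t • w) (nhdsWithin 0 (Set.Ioi 0)) (nhds 0) := by
    have : Continuous (fun t : ℝ => t • w) := by fun_prop
    have h2 := this.tendsto 0
    simp only [zero_smul] at h2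
    exact h2.mono_left nhdsWithin_le_nhds
  obtain ⟨t, ht, ht0⟩ :=
    ((hc.eventually (mem_interior_iff_mem_nhds.1 hint)).and self_mem_nhdsWithin).exists
  have ht0 : 0 < t := ht0
  obtain ⟨c, hc, hs⟩ := hsub ht
  refine ⟨fun i => t⁻¹ * c i, fun i hi => mul_nonneg (inv_nonneg.2 ht0.le) (hc i hi), ?_⟩
  simp only [mul_smul, ← Finset.smul_sum, hs]
  rw [smul_smul, inv_mul_cancel₀ ht0.ne', one_smul]

theorem eq_zero_of_indep_pair {u v : Fin 2 → ℝ} (h : LinearIndependent ℝ ![u, v])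
    (f : (Fin 2 → ℝ) →ₗ[ℝ] ℝ) (hu : f u = 0) (hv : f v = 0) : f = 0 := by
  have hs := h.span_eq_top_of_card_eq_finrank' (by simp)
  apply LinearMap.ext_on_range (v := ![u, v]) hs
  intro i
  fin_cases i <;> simp [hu, hv]

theorem steinitz_step {ι : Type*} [DecidableEq ι] (φ : ι → Fin 2 → ℝ) (S : Finset ι)
    (h : Surr (φ '' (S : Set ι)) 0)
    (hmin : ∀ x ∈ S, ¬ Surr (φ '' ((S.erase x : Finset ι) : Set ι)) 0) (a : ι) (ha : a ∈ S) :
    φ a ≠ 0 ∧ (S.card ≤ 3 ∨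
      ∃ a' ∈ S, ∃ α α' : ℝ, 0 < α ∧ 0 < α' ∧ α • φ a + α' • φ a' = 0) := by
  have ha0 : φ a ≠ 0 := by
    intro h0
    apply hmin a ha
    intro f hf
    obtain ⟨_, ⟨x, hx, rfl⟩, hpos⟩ := h f hf
    refine ⟨φ x, ⟨x, ?_, rfl⟩, hpos⟩
    have : x ≠ a := by
      rintro rfl
      simp [h0] at hpos
    simp [this, Finset.mem_coe.1 hx]
  refine ⟨ha0, ?_⟩
  obtain ⟨c, hc, hsum⟩ := h.exists_cone ⟨a, ha⟩ (-φ a)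
  obtain ⟨T, hTS, c', hc', hsum', hli⟩ := conic_caratheodory φ S c hc
  rw [hsum] at hsum'
  have hcard : T.card ≤ 2 := by
    have := hli.fintype_card_le_finrank
    simpa using this
  have h012 : T.card = 0 ∨ T.card = 1 ∨ T.card = 2 := by omega
  rcases h012 with h0 | h1 | h2
  · rw [Finset.card_eq_zero] at h0
    subst h0
    simp at hsum'
    exact absurd hsum' ha0
  · obtain ⟨b, rfl⟩ := Finset.card_eq_one.1 h1
    right
    refine ⟨b, hTS (by simp), 1, c' b, one_pos, hc' b (by simp), ?_⟩
    simp at hsum'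
    rw [hsum']; simp
  · obtain ⟨b, d, hbd, rfl⟩ := Finset.card_eq_two.1 h2
    left
    have hli2 : LinearIndependent ℝ ![φ b, φ d] := by
      have := hli.comp (![⟨b, by simp⟩, ⟨d, by simp⟩] : Fin 2 → ({b, d} : Finset ι)) (by
        intro i j hij
        fin_cases i <;> fin_cases j <;> simp_all)
      have heq : ![φ b, φ d] = (fun i : ({b, d} : Finset ι) => φ i) ∘
          (![⟨b, by simp⟩, ⟨d, by simp⟩] : Fin 2 → ({b, d} : Finset ι)) := by
        funext i
        fin_cases i <;> rfl
      rw [heq]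
      exact this
    rw [Finset.sum_pair hbd] at hsum'
    have hb := hc' b (by simp)
    have hd := hc' d (by simp)
    have hs3 : Surr (φ '' (({a, b, d} : Finset ι) : Set ι)) 0 := by
      intro f hf
      by_contra hcon
      push Not at hcon
      have ea := hcon (φ a) ⟨a, by simp, rfl⟩
      have eb := hcon (φ b) ⟨b, by simp, rfl⟩
      have ed := hcon (φ d) ⟨d, by simp, rfl⟩
      rw [sub_zero] at ea eb ed
      have e := congrArg f hsum'
      simp only [map_add, map_smul, map_neg, smul_eq_mul] at e
      apply hf
      apply eq_zero_of_indep_pair hli2 f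
      · nlinarith [mul_nonneg hb.le (neg_nonneg.2 eb), mul_nonneg hd.le (neg_nonneg.2 ed)]
      · nlinarith [mul_nonneg hb.le (neg_nonneg.2 eb), mul_nonneg hd.le (neg_nonneg.2 ed)]
    have hsub : S ⊆ {a, b, d} := by
      intro x hx
      by_contra hxn
      apply hmin x hx
      apply hs3.mono
      apply Set.image_mono
      intro y hy
      have hy' := Finset.mem_coe.1 hy
      rw [Finset.mem_coe, Finset.mem_erase]
      refine ⟨by rintro rfl; exact hxn hy', ?_⟩
      simp only [Finset.mem_insert, Finset.mem_singleton] at hy'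
      rcases hy' with rfl | rfl | rfl
      · exact ha
      · exact hTS (by simp)
      · exact hTS (by simp)
    exact (Finset.card_le_card hsub).trans Finset.card_le_three

theorem steinitz2 {ι : Type*} [DecidableEq ι] (φ : ι → Fin 2 → ℝ) (S : Finset ι)
    (hne : S.Nonempty) (h : Surr (φ '' (S : Set ι)) 0)
    (hmin : ∀ x ∈ S, ¬ Surr (φ '' ((S.erase x : Finset ι) : Set ι)) 0) :
    S.card ≤ 3 ∨ ∃ a a' b b' : ι, S = {a, a', b, b'} ∧
      (∃ α α' : ℝ, 0 < α ∧ 0 < α' ∧ α • φ a + α' • φ a' = 0) ∧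
      (∃ β β' : ℝ, 0 < β ∧ 0 < β' ∧ β • φ b + β' • φ b' = 0) := by
  obtain ⟨a, ha⟩ := hne
  obtain ⟨ha0, hc | ⟨a', ha', α, α', hα, hα', ea⟩⟩ := steinitz_step φ S h hmin a ha
  · exact Or.inl hc
  obtain ⟨f, hf, hker⟩ := Submodule.exists_le_ker_of_lt_top (Submodule.span ℝ {φ a}) (by
    rw [lt_top_iff_ne_top]
    intro htop
    have h1 := finrank_span_singleton (K := ℝ) ha0
    rw [htop, finrank_top] at h1
    simp at h1)
  have hfa : f (φ a) = 0 := hker (Submodule.mem_span_singleton_self _)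
  obtain ⟨_, ⟨b, hb, rfl⟩, hfb⟩ := h f hf
  rw [sub_zero] at hfb
  obtain ⟨hb0, hc | ⟨b', hb', β, β', hβ, hβ', eb⟩⟩ := steinitz_step φ S h hmin b hb
  · exact Or.inl hc
  right
  refine ⟨a, a', b, b', ?_, ⟨α, α', hα, hα', ea⟩, ⟨β, β', hβ, hβ', eb⟩⟩
  have hli2 : LinearIndependent ℝ ![φ a, φ b] := by
    rw [LinearIndependent.pair_iff]
    intro s t hst
    have e := congrArg f hst
    simp only [map_add, map_smul, smul_eq_mul, hfa, mul_zero, zero_add, map_zero] at e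
    have ht : t = 0 := by
      rcases mul_eq_zero.1 e with h | h
      · exact h
      · exact absurd h hfb.ne'
    subst ht
    simp only [zero_smul, add_zero] at hst
    exact ⟨(smul_eq_zero.1 hst).resolve_right ha0, rfl⟩
  have hs4 : Surr (φ '' (({a, a', b, b'} : Finset ι) : Set ι)) 0 := by
    intro g hg
    by_contra hcon
    push Not at hcon
    have e1 := hcon (φ a) ⟨a, by simp, rfl⟩
    have e2 := hcon (φ a') ⟨a', by simp, rfl⟩
    have e3 := hcon (φ b) ⟨b, by simp, rfl⟩
    have e4 := hcon (φ b') ⟨b', by simp, rfl⟩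
    rw [sub_zero] at e1 e2 e3 e4
    have e := congrArg g ea
    have e' := congrArg g eb
    simp only [map_add, map_smul, map_zero, smul_eq_mul] at e e'
    apply hg
    apply eq_zero_of_indep_pair hli2 g
    · nlinarith [mul_nonneg hα.le (neg_nonneg.2 e1), mul_nonneg hα'.le (neg_nonneg.2 e2)]
    · nlinarith [mul_nonneg hβ.le (neg_nonneg.2 e3), mul_nonneg hβ'.le (neg_nonneg.2 e4)]
  have hsub' : ({a, a', b, b'} : Finset ι) ⊆ S := by
    intro x hx
    simp only [Finset.mem_insert, Finset.mem_singleton] at hx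
    rcases hx with rfl | rfl | rfl | rfl <;> assumption
  apply Finset.Subset.antisymm _ hsub'
  intro x hx
  by_contra hxn
  apply hmin x hx
  apply hs4.mono
  apply Set.image_mono
  intro y hy
  have hy' := Finset.mem_coe.1 hy
  rw [Finset.mem_coe, Finset.mem_erase]
  have hyx : y ≠ x := by rintro rfl; exact hxn hy'
  have hyS : y ∈ S := hsub' hy'
  exact ⟨hyx, hyS⟩

/-- Projection along a nonzero direction. -/
theorem exists_proj (d : Fin 3 → ℝ) (hd : d ≠ 0) :
    ∃ π : (Fin 3 → ℝ) →ₗ[ℝ] (Fin 2 → ℝ), (∀ x, π x = 0 → ∃ t : ℝ, x = t • d) ∧ Function.Surjective π ∧ π d = 0 ∧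
      ∀ f : (Fin 3 → ℝ) →ₗ[ℝ] ℝ, f d = 0 → ∃ g : (Fin 2 → ℝ) →ₗ[ℝ] ℝ, f = g ∘ₗ π := by
  have hfr : Module.finrank ℝ ((Fin 3 → ℝ) ⧸ Submodule.span ℝ {d})
      = Module.finrank ℝ (Fin 2 → ℝ) := by
    have h1 := Submodule.finrank_quotient_add_finrank (Submodule.span ℝ {d})
    rw [finrank_span_singleton hd] at h1
    simp at h1 ⊢
    omega
  let e := LinearEquiv.ofFinrankEq _ _ hfr
  refine ⟨e.toLinearMap ∘ₗ (Submodule.span ℝ {d}).mkQ, ?_, ?_, ?_, ?_⟩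
  · intro x hx
    simp only [LinearMap.comp_apply, LinearEquiv.coe_coe, LinearEquiv.map_eq_zero_iff,
      Submodule.mkQ_apply, Submodule.Quotient.mk_eq_zero] at hx
    obtain ⟨t, ht⟩ := Submodule.mem_span_singleton.1 hx
    exact ⟨t, ht.symm⟩
  · rw [LinearMap.coe_comp]
    exact e.surjective.comp (Submodule.mkQ_surjective _)
  · simp only [LinearMap.comp_apply, LinearEquiv.coe_coe, LinearEquiv.map_eq_zero_iff,
      Submodule.mkQ_apply, Submodule.Quotient.mk_eq_zero]
    exact Submodule.mem_span_singleton_self _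
  · intro f hf
    refine ⟨(Submodule.span ℝ {d}).liftQ f ?_ ∘ₗ e.symm.toLinearMap, ?_⟩
    · rw [Submodule.span_singleton_le_iff_mem]
      exact hf
    · ext i
      simp

/-- `S` surrounds `p` modulo the direction `d`. -/
def PosMod (S : Set (Fin 3 → ℝ)) (p d : Fin 3 → ℝ) : Prop :=
  ∀ f : (Fin 3 → ℝ) →ₗ[ℝ] ℝ, f ≠ 0 → f d = 0 → ∃ x ∈ S, 0 < f (x - p)

theorem steinitz_mod (S : Finset (Fin 3 → ℝ)) (hne : S.Nonempty) (p d : Fin 3 → ℝ) (hd : d ≠ 0)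
    (h : PosMod S p d) (hmin : ∀ x ∈ S, ¬ PosMod ((S.erase x : Finset _) : Set _) p d) :
    S.card ≤ 3 ∨ ∃ a a' b b' : Fin 3 → ℝ, S = {a, a', b, b'} ∧
      (∃ α α' τ : ℝ, 0 < α ∧ 0 < α' ∧ α • (a - p) + α' • (a' - p) = τ • d) ∧
      (∃ β β' τ : ℝ, 0 < β ∧ 0 < β' ∧ β • (b - p) + β' • (b' - p) = τ • d) := by
  obtain ⟨π, hπ, hsurj, hπd, hfac⟩ := exists_proj d hd
  have key : ∀ T : Set (Fin 3 → ℝ), PosMod T p d ↔ Surr ((fun x => π (x - p)) '' T) 0 := by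
    intro T
    constructor
    · intro hT g hg
      obtain ⟨x, hx, hpos⟩ := hT (g ∘ₗ π) (by
        intro h0
        apply hg
        apply LinearMap.ext
        intro y
        obtain ⟨z, rfl⟩ := hsurj y
        exact LinearMap.congr_fun h0 z) (by simp [hπd])
      exact ⟨_, ⟨x, hx, rfl⟩, by rw [sub_zero]; exact hpos⟩
    · intro hT f hf hfd
      obtain ⟨g, rfl⟩ := hfac f hfd
      obtain ⟨_, ⟨x, hx, rfl⟩, hpos⟩ := hT g (by rintro rfl; exact hf (LinearMap.zero_comp _))
      rw [sub_zero] at hpos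
      exact ⟨x, hx, hpos⟩
  rcases steinitz2 (fun x => π (x - p)) S hne ((key _).1 h)
    (fun x hx hh => hmin x hx ((key _).2 hh)) with h3 | ⟨a, a', b, b', hS, ⟨α, α', h1, h2, h3⟩,
      ⟨β, β', h4, h5, h6⟩⟩
  · exact Or.inl h3
  · right
    refine ⟨a, a', b, b', hS, ?_, ?_⟩
    · rw [← map_smul, ← map_smul, ← map_add] at h3
      obtain ⟨τ, hτ⟩ := hπ _ h3
      exact ⟨α, α', τ, h1, h2, hτ⟩
    · rw [← map_smul, ← map_smul, ← map_add] at h6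
      obtain ⟨τ, hτ⟩ := hπ _ h6
      exact ⟨β, β', τ, h4, h5, hτ⟩

/-- `p` lies in the relative interior of the cone at `v` over `x, y`. -/
def InCone (v p x y : Fin 3 → ℝ) : Prop :=
  ∃ α α' : ℝ, 0 < α ∧ 0 < α' ∧ p - v = α • (x - v) + α' • (y - v)

theorem InCone.symm {v p x y : Fin 3 → ℝ} (h : InCone v p x y) : InCone v p y x := by
  obtain ⟨α, α', h1, h2, h3⟩ := h
  exact ⟨α', α, h2, h1, by rw [h3, add_comm]⟩

theorem exists_kill (u w : Fin 3 → ℝ) :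
    ∃ f : (Fin 3 → ℝ) →ₗ[ℝ] ℝ, f ≠ 0 ∧ f u = 0 ∧ f w = 0 := by
  obtain ⟨f, hf, hker⟩ := Submodule.exists_le_ker_of_lt_top (Submodule.span ℝ {u, w}) (by
    rw [lt_top_iff_ne_top]
    intro htop
    have h1 := finrank_span_finset_le_card (R := ℝ) ({u, w} : Finset (Fin 3 → ℝ))
    have h2 := Finset.card_le_two (a := u) (b := w)
    simp only [Finset.coe_insert, Finset.coe_singleton] at h1
    rw [Set.finrank, htop, finrank_top] at h1
    simp at h1
    omega)
  exact ⟨f, hf, hker (Submodule.subset_span (by simp)), hker (Submodule.subset_span (by simp))⟩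

theorem incone_of_rel {v p a a' : Fin 3 → ℝ} (f : (Fin 3 → ℝ) →ₗ[ℝ] ℝ)
    (hfv : 0 < f (v - p)) (hfa : f (a - p) ≤ 0) (hfa' : f (a' - p) ≤ 0)
    (h : ∃ α α' τ : ℝ, 0 < α ∧ 0 < α' ∧ α • (a - p) + α' • (a' - p) = τ • (v - p)) :
    InCone v p a a' := by
  obtain ⟨α, α', τ, h1, h2, h3⟩ := h
  have hτ : τ ≤ 0 := by
    have e := congrArg f h3
    simp only [map_add, map_smul, smul_eq_mul] at e
    by_contra hh
    push Not at hh
    nlinarith [mul_pos hh hfv, mul_nonneg h1.le (neg_nonneg.2 hfa),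
      mul_nonneg h2.le (neg_nonneg.2 hfa')]
  have hσ : 0 < α + α' - τ := by linarith
  refine ⟨α / (α + α' - τ), α' / (α + α' - τ), by positivity, by positivity, ?_⟩
  ext i
  have e := congrFun h3 i
  simp only [Pi.add_apply, Pi.smul_apply, Pi.sub_apply, smul_eq_mul] at e ⊢
  field_simp
  linarith

theorem bad_step (V : Finset (Fin 3 → ℝ)) (v p q : Fin 3 → ℝ) (f : (Fin 3 → ℝ) →ₗ[ℝ] ℝ)
    (hv : v ∈ V) (hp : Surr (V : Set _) p)
    (hmin : ∀ u ∈ V, ¬ Surr (((V.erase u : Finset _) : Set _) ∪ {p, q}) p)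
    (hfx : ∀ x ∈ V.erase v, f (x - p) ≤ 0) (hfv : 0 < f (v - p)) (hfq : f (q - p) < 0) :
    V.card ≤ 4 ∨ ∃ a a' b b' : Fin 3 → ℝ, V.erase v = {a, a', b, b'} ∧
      InCone v p a a' ∧ InCone v p b b' := by
  have hd : v - p ≠ 0 := by
    intro h0
    rw [h0, map_zero] at hfv
    exact lt_irrefl _ hfv
  have hpos : PosMod ((V.erase v : Finset _) : Set _) p (v - p) := by
    intro h hh hhv
    obtain ⟨x, hx, hx0⟩ := hp h hh
    refine ⟨x, ?_, hx0⟩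
    rw [Finset.mem_coe, Finset.mem_erase]
    refine ⟨?_, hx⟩
    rintro rfl
    rw [hhv] at hx0
    exact lt_irrefl _ hx0
  have hne : (V.erase v).Nonempty := by
    obtain ⟨h, hh, hv0, _⟩ := exists_kill (v - p) 0
    obtain ⟨x, hx, _⟩ := hpos h hh hv0
    exact ⟨x, hx⟩
  have hcard : V.card = (V.erase v).card + 1 := (Finset.card_erase_add_one hv).symm
  rcases steinitz_mod (V.erase v) hne p (v - p) hd hpos (by
    intro u hu hpu
    have huV := Finset.mem_of_mem_erase hu
    have huv : u ≠ v := Finset.ne_of_mem_erase hu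
    apply hmin u huV
    intro h hh
    by_contra hcon
    push Not at hcon
    have hhq := hcon q (by simp)
    have hhv := hcon v (Or.inl (by simp [huv.symm, hv]))
    have hhx : ∀ x ∈ (V.erase v).erase u, h (x - p) ≤ 0 := by
      intro x hx
      apply hcon x
      left
      simp only [Finset.mem_erase] at hx
      simp [hx.1, hx.2.2]
    by_cases hk0 : h (v - p) = 0
    · obtain ⟨x, hx, hx0⟩ := hpu h hh hk0
      exact absurd (hhx x hx) (not_le.2 hx0)
    have hk : h (v - p) < 0 := lt_of_le_of_ne hhv hk0
    set s := -h (v - p) / f (v - p) with hs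
    have hs0 : 0 < s := div_pos (by linarith) hfv
    by_cases hz : h + s • f = 0
    · have e := LinearMap.congr_fun hz (q - p)
      simp only [LinearMap.add_apply, LinearMap.smul_apply, smul_eq_mul,
        LinearMap.zero_apply] at e
      nlinarith [mul_neg_of_pos_of_neg hs0 hfq]
    · obtain ⟨x, hx, hx0⟩ := hpu (h + s • f) hz (by
        simp only [LinearMap.add_apply, LinearMap.smul_apply, smul_eq_mul]
        rw [hs, div_mul_cancel₀ _ hfv.ne']
        ring)
      simp only [LinearMap.add_apply, LinearMap.smul_apply, smul_eq_mul] at hx0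
      have h1 := hhx x hx
      have h2 := hfx x (Finset.mem_of_mem_erase hx)
      nlinarith [mul_nonneg hs0.le (neg_nonneg.2 h2)]) with h3 | ⟨a, a', b, b', hS, h1, h2⟩
  · left; omega
  · right
    refine ⟨a, a', b, b', hS, ?_, ?_⟩
    · exact incone_of_rel f hfv (hfx _ (by rw [hS]; simp)) (hfx _ (by rw [hS]; simp)) h1
    · exact incone_of_rel f hfv (hfx _ (by rw [hS]; simp)) (hfx _ (by rw [hS]; simp)) h2

theorem cross_false {v p q a a' b b' : Fin 3 → ℝ}
    (hspan : ∀ h : (Fin 3 → ℝ) →ₗ[ℝ] ℝ, h (a - v) = 0 → h (a' - v) = 0 → h (b - v) = 0 →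
      h (b' - v) = 0 → h = 0)
    (h1 : InCone v p a a') (h2 : InCone v p b b')
    (h3 : InCone v q a b) (h4 : InCone v q a' b') : False := by
  obtain ⟨h, hh, ha, ha'⟩ := exists_kill (a - v) (a' - v)
  obtain ⟨α, α', _, _, e1⟩ := h1
  obtain ⟨β, β', hβ, hβ', e2⟩ := h2
  obtain ⟨A, B, _, hB, e3⟩ := h3
  obtain ⟨A', B', _, hB', e4⟩ := h4
  have e5 := congrArg h (e1.symm.trans e2)
  have e6 := congrArg h (e3.symm.trans e4)
  simp only [map_add, map_smul, smul_eq_mul, ha, ha', mul_zero, zero_add, add_zero] at e5 e6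
  have hb : h (b - v) = 0 := by
    have : (B * β' + B' * β) * h (b - v) = 0 := by linear_combination (-B') * e5 + β' * e6
    exact (mul_eq_zero.1 this).resolve_left (by positivity)
  have hb' : h (b' - v) = 0 := by
    rw [hb, mul_zero] at e6
    exact (mul_eq_zero.1 e6.symm).resolve_left hB'.ne'
  exact hh (hspan h ha ha' hb hb')

theorem same_parallel {v p q a a' : Fin 3 → ℝ} (h : (Fin 3 → ℝ) →ₗ[ℝ] ℝ)
    (hp : h (p - v) = 0) (hq : h (q - v) = 0)
    (h1 : InCone v p a a') (h2 : InCone v q a a') :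
    (∃ k : ℝ, 0 < k ∧ q - v = k • (p - v)) ∨ (h (a - v) = 0 ∧ h (a' - v) = 0) := by
  obtain ⟨α, α', hα, hα', e1⟩ := h1
  obtain ⟨A, A', hA, hA', e2⟩ := h2
  have e3 := congrArg h e1
  have e4 := congrArg h e2
  simp only [map_add, map_smul, smul_eq_mul, hp, hq] at e3 e4
  by_cases ha : h (a - v) = 0
  · right
    refine ⟨ha, ?_⟩
    rw [ha, mul_zero, zero_add] at e3
    exact (mul_eq_zero.1 e3.symm).resolve_left hα'.ne'
  · left
    have h5 : (A' * α - α' * A) * h (a - v) = 0 := by linear_combination (-A') * e3 + α' * e4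
    have h6 : A' * α = α' * A := by
      have := (mul_eq_zero.1 h5).resolve_right ha
      linarith
    refine ⟨A / α, by positivity, ?_⟩
    rw [e1, e2]
    ext i
    simp only [Pi.add_apply, Pi.smul_apply, Pi.sub_apply, smul_eq_mul]
    field_simp
    linear_combination (a' i - v i) * h6

theorem card_le_four (V : Finset (Fin 3 → ℝ)) (p q : Fin 3 → ℝ) (hpq : p ≠ q)
    (hp : Surr (V : Set _) p) (hq : Surr (V : Set _) q)
    (hpv : ∀ v ∈ V, ¬ Surr (((V.erase v : Finset _) : Set _) ∪ {p, q}) p)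
    (hqv : ∀ v ∈ V, ¬ Surr (((V.erase v : Finset _) : Set _) ∪ {q, p}) q) : V.card ≤ 4 := by
  have hd : q - p ≠ 0 := sub_ne_zero.2 hpq.symm
  have hne : V.Nonempty := by
    obtain ⟨h, hh, _⟩ := exists_kill 0 0
    obtain ⟨x, hx, _⟩ := hp h hh
    exact ⟨x, hx⟩
  by_cases hgood : ∀ v ∈ V, ¬ PosMod ((V.erase v : Finset _) : Set _) p (q - p)
  · rcases steinitz_mod V hne p (q - p) hd (fun f hf _ => hp f hf) hgood with
      h3 | ⟨a, a', b, b', hS, -, -⟩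
    · omega
    · rw [hS]; exact Finset.card_le_four
  push Not at hgood
  obtain ⟨v, hv, hpos⟩ := hgood
  have hf := hpv v hv
  have hg := hqv v hv
  unfold Surr at hf hg
  push Not at hf hg
  obtain ⟨f, hf0, hf⟩ := hf
  obtain ⟨g, hg0, hg⟩ := hg
  have hfx : ∀ x ∈ V.erase v, f (x - p) ≤ 0 := fun x hx => hf x (Or.inl hx)
  have hgx : ∀ x ∈ V.erase v, g (x - q) ≤ 0 := fun x hx => hg x (Or.inl hx)
  have hfv : 0 < f (v - p) := by
    obtain ⟨x, hx, hx0⟩ := hp f hf0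
    by_cases hxv : x = v
    · exact hxv ▸ hx0
    · exact absurd (hfx x (Finset.mem_erase.2 ⟨hxv, hx⟩)) (not_le.2 hx0)
  have hgv : 0 < g (v - q) := by
    obtain ⟨x, hx, hx0⟩ := hq g hg0
    by_cases hxv : x = v
    · exact hxv ▸ hx0
    · exact absurd (hgx x (Finset.mem_erase.2 ⟨hxv, hx⟩)) (not_le.2 hx0)
  have hfq : f (q - p) < 0 := by
    refine lt_of_le_of_ne (hf q (by simp)) ?_
    intro h0
    obtain ⟨x, hx, hx0⟩ := hpos f hf0 h0
    exact absurd (hfx x hx) (not_le.2 hx0)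
  have hgp : g (p - q) < 0 := by
    refine lt_of_le_of_ne (hg p (by simp)) ?_
    intro h0
    have h0' : g (q - p) = 0 := by rw [← neg_sub, map_neg, h0, neg_zero]
    obtain ⟨x, hx, hx0⟩ := hpos g hg0 h0'
    have h1 := hgx x hx
    have h2 : g (x - p) = g (x - q) + g (q - p) := by rw [← map_add]; congr 1; abel
    linarith
  by_contra hcard
  have hcard' : 4 ≤ (V.erase v).card := by
    rw [Finset.card_erase_of_mem hv]; omega
  obtain ⟨a, a', b, b', hS, hpa, hpb⟩ :=
    (bad_step V v p q f hv hp hpv hfx hfv hfq).resolve_left hcard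
  obtain ⟨c, c', e, e', hS', hqc, hqe⟩ :=
    (bad_step V v q p g hv hq hqv hgx hgv hgp).resolve_left hcard
  have hspan : ∀ h : (Fin 3 → ℝ) →ₗ[ℝ] ℝ, h (a - v) = 0 → h (a' - v) = 0 → h (b - v) = 0 →
      h (b' - v) = 0 → h = 0 := by
    intro h h1 h2 h3 h4
    by_contra hh
    have hc : ∀ x ∈ V, h (x - p) = h (v - p) := by
      intro x hx
      have h5 : h (x - v) = 0 := by
        by_cases hxv : x = v
        · rw [hxv, sub_self, map_zero]
        · have : x ∈ V.erase v := Finset.mem_erase.2 ⟨hxv, hx⟩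
          rw [hS] at this
          simp only [Finset.mem_insert, Finset.mem_singleton] at this
          rcases this with rfl | rfl | rfl | rfl <;> assumption
      have h6 : h (x - p) = h (x - v) + h (v - p) := by rw [← map_add]; congr 1; abel
      rw [h6, h5, zero_add]
    obtain ⟨x, hx, hx0⟩ := hp h hh
    obtain ⟨y, hy, hy0⟩ := hp (-h) (neg_ne_zero.2 hh)
    rw [LinearMap.neg_apply, hc y hy] at hy0
    rw [hc x hx] at hx0
    linarith
  have hmatch : (InCone v q a a' ∧ InCone v q b b') ∨ (InCone v q a b ∧ InCone v q a' b') ∨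
      (InCone v q a b' ∧ InCone v q a' b) := by
    have hset : ({c, c', e, e'} : Finset (Fin 3 → ℝ)) = {a, a', b, b'} := by rw [← hS, ← hS']
    have hdist : c ≠ c' ∧ c ≠ e ∧ c ≠ e' ∧ c' ≠ e ∧ c' ≠ e' ∧ e ≠ e' := by
      rw [hS'] at hcard'
      refine ⟨?_, ?_, ?_, ?_, ?_, ?_⟩ <;> rintro rfl
      · have := Finset.card_le_three (a := c) (b := e) (c := e')
        simp at hcard'; omega
      · have := Finset.card_le_three (a := c) (b := c') (c := e')
        rw [show ({c, c', c, e'} : Finset (Fin 3 → ℝ)) = {c, c', e'} by ext; simp; tauto] at hcard'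
        omega
      · have := Finset.card_le_three (a := c) (b := c') (c := e)
        rw [show ({c, c', e, c} : Finset (Fin 3 → ℝ)) = {c, c', e} by ext; simp; tauto] at hcard'
        omega
      · have := Finset.card_le_three (a := c) (b := c') (c := e')
        rw [show ({c, c', c', e'} : Finset (Fin 3 → ℝ)) = {c, c', e'} by ext; simp] at hcard'
        omega
      · have := Finset.card_le_three (a := c) (b := c') (c := e)
        rw [show ({c, c', e, c'} : Finset (Fin 3 → ℝ)) = {c, c', e} by ext; simp; tauto] at hcard'
        omega
      · have := Finset.card_le_three (a := c) (b := c') (c := e)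
        rw [show ({c, c', e, e} : Finset (Fin 3 → ℝ)) = {c, c', e} by ext; simp] at hcard'
        omega
    obtain ⟨d1, d2, d3, d4, d5, d6⟩ := hdist
    have m1 : c ∈ ({a, a', b, b'} : Finset (Fin 3 → ℝ)) := by rw [← hset]; simp
    have m2 : c' ∈ ({a, a', b, b'} : Finset (Fin 3 → ℝ)) := by rw [← hset]; simp
    have m3 : e ∈ ({a, a', b, b'} : Finset (Fin 3 → ℝ)) := by rw [← hset]; simp
    have m4 : e' ∈ ({a, a', b, b'} : Finset (Fin 3 → ℝ)) := by rw [← hset]; simp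
    simp only [Finset.mem_insert, Finset.mem_singleton] at m1 m2 m3 m4
    have hqc' := hqc.symm
    have hqe' := hqe.symm
    clear hset hS hS' hspan hpa hpb hcard'
    rcases m1 with h1 | h1 | h1 | h1 <;> rcases m2 with h2 | h2 | h2 | h2 <;>
      first
      | exact absurd (h1.trans h2.symm) d1
      | (rcases m3 with h3 | h3 | h3 | h3 <;>
          first
          | exact absurd (h1.trans h3.symm) d2
          | exact absurd (h2.trans h3.symm) d4
          | (rcases m4 with h4 | h4 | h4 | h4 <;>
              first
              | exact absurd (h1.trans h4.symm) d3
              | exact absurd (h2.trans h4.symm) d5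
              | exact absurd (h3.trans h4.symm) d6
              | (rw [h1, h2] at hqc hqc'
                 rw [h3, h4] at hqe hqe'
                 first
                 | exact Or.inl ⟨by assumption, by assumption⟩
                 | exact Or.inr (Or.inl ⟨by assumption, by assumption⟩)
                 | exact Or.inr (Or.inr ⟨by assumption, by assumption⟩))))
  rcases hmatch with ⟨h1, h2⟩ | ⟨h1, h2⟩ | ⟨h1, h2⟩
  · obtain ⟨h, hh, hp0, hq0⟩ := exists_kill (p - v) (q - v)
    have hk : ∃ k : ℝ, 0 < k ∧ q - v = k • (p - v) := by
      rcases same_parallel h hp0 hq0 hpa h1 with hk | ⟨e1, e2⟩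
      · exact hk
      rcases same_parallel h hp0 hq0 hpb h2 with hk | ⟨e3, e4⟩
      · exact hk
      exact absurd (hspan h e1 e2 e3 e4) hh
    obtain ⟨k, hk, ek⟩ := hk
    have e1 := congrArg f ek
    have e2 := congrArg g ek
    simp only [map_sub, map_smul, smul_eq_mul] at e1 e2 hfv hgv hfq hgp
    have k1 : 1 < k := by
      by_contra hcon
      push Not at hcon
      nlinarith
    nlinarith
  · exact cross_false hspan hpa hpb h1 h2
  · exact cross_false (fun h e1 e2 e3 e4 => hspan h e1 e2 e4 e3) hpa hpb.symm h1 h2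

/-- Pairing relation on four numbers. -/
def Pairing (s0 s1 s2 s3 : ℝ) : Prop :=
  (s0 = s1 ∧ s2 = s3) ∨ (s0 = s2 ∧ s1 = s3) ∨ (s0 = s3 ∧ s1 = s2)

theorem sq_case {x y z w : ℝ} (hx : 0 < x) (hy : 0 < y) (hz : 0 < z) (hw : 0 < w)
    (h1 : z * y = w * x) (h2 : w * y = z * x) : x = y := by
  have h3 : (z + w) * (y - x) = 0 := by linarith
  rcases mul_eq_zero.1 h3 with h | h <;> linarith

theorem fixed_pairing (p0 p1 p2 p3 s0 s1 s2 s3 t0 t1 t2 t3 : ℝ)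
    (hp0 : 0 < p0) (hp1 : 0 < p1) (hp2 : 0 < p2) (hp3 : 0 < p3)
    (hp : p0 + p1 + p2 + p3 = 1)
    (ps0 : 0 < s0) (ps2 : 0 < s2)
    (pt0 : 0 < t0) (pt1 : 0 < t1)
    (hs : p0 * s0 + p1 * s1 + p2 * s2 + p3 * s3 = 1)
    (ht : p0 * t0 + p1 * t1 + p2 * t2 + p3 * t3 = 1)
    (h01 : s0 = s1) (h23 : s2 = s3) (hne : s0 ≠ s2)
    (hT : Pairing t0 t1 t2 t3)
    (hU : (t0 * s1 = t1 * s0 ∧ t2 * s3 = t3 * s2) ∨ (t0 * s2 = t2 * s0 ∧ t1 * s3 = t3 * s1) ∨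
      (t0 * s3 = t3 * s0 ∧ t1 * s2 = t2 * s1)) :
    ∃ T : ℝ, t0 - 1 = T * (s0 - 1) ∧ t1 - 1 = T * (s1 - 1) ∧ t2 - 1 = T * (s2 - 1) ∧
      t3 - 1 = T * (s3 - 1) := by
  subst h01 h23
  have same : t0 = t1 → t2 = t3 → ∃ T : ℝ, t0 - 1 = T * (s0 - 1) ∧ t1 - 1 = T * (s0 - 1) ∧
      t2 - 1 = T * (s2 - 1) ∧ t3 - 1 = T * (s2 - 1) := by
    intro h1 h2
    subst h1 h2
    have hs1 : s0 - 1 ≠ 0 := by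
      intro h0
      have h0' : s0 = 1 := by linarith
      subst h0'
      have : (p2 + p3) * (s2 - 1) = 0 := by linarith
      rcases mul_eq_zero.1 this with h | h
      · linarith
      · apply hne; linarith
    have k1 : t0 - 1 = (t0 - 1) / (s0 - 1) * (s0 - 1) := by rw [div_mul_cancel₀ _ hs1]
    have k2 : t2 - 1 = (t0 - 1) / (s0 - 1) * (s2 - 1) := by
      have hm : p2 + p3 ≠ 0 := by positivity
      have e1 : (p2 + p3) * (t2 - 1) = - (p0 + p1) * (t0 - 1) := by linarith
      have e2 : (p2 + p3) * (s2 - 1) = - (p0 + p1) * (s0 - 1) := by linarith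
      apply mul_left_cancel₀ hm
      calc (p2 + p3) * (t2 - 1) = - (p0 + p1) * (t0 - 1) := e1
        _ = (t0 - 1) / (s0 - 1) * (- (p0 + p1) * (s0 - 1)) := by field_simp
        _ = (t0 - 1) / (s0 - 1) * ((p2 + p3) * (s2 - 1)) := by rw [e2]
        _ = _ := by ring
    exact ⟨(t0 - 1) / (s0 - 1), k1, k1, k2, k2⟩
  rcases hT with ⟨h1, h2⟩ | ⟨h1, h2⟩ | ⟨h1, h2⟩
  · exact same h1 h2
  · subst h1 h2
    rcases hU with ⟨u1, u2⟩ | ⟨u1, u2⟩ | ⟨u1, u2⟩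
    · have := mul_right_cancel₀ ps0.ne' u1
      exact same this this
    · exact absurd (mul_left_cancel₀ pt0.ne' u1).symm hne
    · exact absurd (sq_case ps0 ps2 pt0 pt1 u1 u2) hne
  · subst h1 h2
    rcases hU with ⟨u1, u2⟩ | ⟨u1, u2⟩ | ⟨u1, u2⟩
    · have := mul_right_cancel₀ ps0.ne' u1
      exact same this this.symm
    · exact absurd (sq_case ps0 ps2 pt0 pt1 u1 u2) hne
    · exact absurd (mul_left_cancel₀ pt0.ne' u1).symm hne

theorem any_pairing (p s t : Fin 4 → ℝ) (hp0 : ∀ i, 0 < p i) (hp : ∑ i, p i = 1)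
    (ps : ∀ i, 0 < s i) (pt : ∀ i, 0 < t i)
    (hs : ∑ i, p i * s i = 1) (ht : ∑ i, p i * t i = 1) (hne : ∃ i, s i ≠ 1)
    (hS : Pairing (s 0) (s 1) (s 2) (s 3)) (hT : Pairing (t 0) (t 1) (t 2) (t 3))
    (hU : Pairing (t 0 / s 0) (t 1 / s 1) (t 2 / s 2) (t 3 / s 3)) :
    ∃ T : ℝ, ∀ i, t i - 1 = T * (s i - 1) := by
  simp only [Fin.sum_univ_four] at hp hs ht
  have hall : ∀ x : ℝ, s 0 = x → s 1 = x → s 2 = x → s 3 = x → False := by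
    intro x h0 h1 h2 h3
    rw [h0, h1, h2, h3] at hs
    have hx : x = 1 := by
      have : (p 0 + p 1 + p 2 + p 3) * x = 1 := by linarith
      rwa [hp, one_mul] at this
    subst hx
    obtain ⟨i, hi⟩ := hne
    fin_cases i
    · exact hi h0
    · exact hi h1
    · exact hi h2
    · exact hi h3
  unfold Pairing at hU
  have hd : ∀ i j, t i / s i = t j / s j ↔ t i * s j = t j * s i := fun i j =>
    div_eq_div_iff (ps i).ne' (ps j).ne'
  simp only [hd] at hU
  rcases hS with ⟨h1, h2⟩ | ⟨h1, h2⟩ | ⟨h1, h2⟩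
  · obtain ⟨T, e0, e1, e2, e3⟩ := fixed_pairing (p 0) (p 1) (p 2) (p 3) (s 0) (s 1) (s 2) (s 3)
      (t 0) (t 1) (t 2) (t 3) (hp0 _) (hp0 _) (hp0 _) (hp0 _) hp (ps _) (ps _) (pt _) (pt _) hs ht
      h1 h2 (fun h => hall _ rfl h1.symm h.symm (h2.symm.trans h.symm)) hT hU
    refine ⟨T, fun i => ?_⟩
    fin_cases i <;> assumption
  · obtain ⟨T, e0, e1, e2, e3⟩ := fixed_pairing (p 0) (p 2) (p 1) (p 3) (s 0) (s 2) (s 1) (s 3)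
      (t 0) (t 2) (t 1) (t 3) (hp0 _) (hp0 _) (hp0 _) (hp0 _) (by linarith) (ps _) (ps _)
      (pt _) (pt _) (by linarith) (by linarith)
      h1 h2 (fun h => hall _ rfl h.symm h1.symm (h2.symm.trans h.symm))
      (by unfold Pairing at hT ⊢
          rcases hT with ⟨a, b⟩ | ⟨a, b⟩ | ⟨a, b⟩
          · exact Or.inr (Or.inl ⟨a, b⟩)
          · exact Or.inl ⟨a, b⟩
          · exact Or.inr (Or.inr ⟨a, b.symm⟩))
      (by rcases hU with ⟨a, b⟩ | ⟨a, b⟩ | ⟨a, b⟩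
          · exact Or.inr (Or.inl ⟨a, b⟩)
          · exact Or.inl ⟨a, b⟩
          · exact Or.inr (Or.inr ⟨a, b.symm⟩))
    refine ⟨T, fun i => ?_⟩
    fin_cases i <;> assumption
  · obtain ⟨T, e0, e1, e2, e3⟩ := fixed_pairing (p 0) (p 3) (p 1) (p 2) (s 0) (s 3) (s 1) (s 2)
      (t 0) (t 3) (t 1) (t 2) (hp0 _) (hp0 _) (hp0 _) (hp0 _) (by linarith) (ps _) (ps _)
      (pt _) (pt _) (by linarith) (by linarith)
      h1 h2 (fun h => hall _ rfl h.symm (h2.symm.trans h.symm) h1.symm)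
      (by unfold Pairing at hT ⊢
          rcases hT with ⟨a, b⟩ | ⟨a, b⟩ | ⟨a, b⟩
          · exact Or.inr (Or.inl ⟨a, b.symm⟩)
          · exact Or.inr (Or.inr ⟨a, b.symm⟩)
          · exact Or.inl ⟨a, b⟩)
      (by rcases hU with ⟨a, b⟩ | ⟨a, b⟩ | ⟨a, b⟩
          · exact Or.inr (Or.inl ⟨a, b.symm⟩)
          · exact Or.inr (Or.inr ⟨a, b.symm⟩)
          · exact Or.inl ⟨a, b⟩)
    refine ⟨T, fun i => ?_⟩
    fin_cases i <;> assumption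

theorem pairing_of_no_unique (s : Fin 4 → ℝ) (h1 : ∀ i, ∃ j, j ≠ i ∧ s j ≤ s i)
    (h2 : ∀ i, ∃ j, j ≠ i ∧ s i ≤ s j) : Pairing (s 0) (s 1) (s 2) (s 3) := by
  obtain ⟨i, hi⟩ := Finite.exists_min s
  obtain ⟨k, hk⟩ := Finite.exists_max s
  obtain ⟨j, hji, hj⟩ := h1 i
  obtain ⟨l, hlk, hl⟩ := h2 k
  have hj' : ∀ x, s j ≤ s x := fun x => hj.trans (hi x)
  have hl' : ∀ x, s x ≤ s l := fun x => (hk x).trans hl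
  clear h1 h2 hj hl
  by_cases hd : s i = s k
  · left
    have : ∀ x y, s x = s y := fun x y => by
      have := hi x; have := hi y; have := hk x; have := hk y; linarith
    exact ⟨this _ _, this _ _⟩
  · have e1 : s i = s j := le_antisymm (hi j) (hj' i)
    have e2 : s k = s l := le_antisymm (hl' k) (hk l)
    have n1 : i ≠ k := by rintro rfl; exact hd rfl
    have n2 : i ≠ l := by rintro rfl; exact hd e2.symm
    have n3 : j ≠ k := by rintro rfl; exact hd e1
    have n4 : j ≠ l := by rintro rfl; exact hd (e1.trans e2.symm)
    clear hi hk hj' hl' hd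
    unfold Pairing
    fin_cases i <;> fin_cases j <;> first
      | exact absurd rfl hji
      | (fin_cases k <;> first
          | exact absurd rfl n1
          | exact absurd rfl n3
          | (fin_cases l <;> first
              | exact absurd rfl hlk
              | exact absurd rfl n2
              | exact absurd rfl n4
              | exact Or.inl ⟨e1, e2⟩
              | exact Or.inl ⟨e1.symm, e2⟩
              | exact Or.inl ⟨e1, e2.symm⟩
              | exact Or.inl ⟨e1.symm, e2.symm⟩
              | exact Or.inl ⟨e2, e1⟩
              | exact Or.inl ⟨e2.symm, e1⟩
              | exact Or.inl ⟨e2, e1.symm⟩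
              | exact Or.inl ⟨e2.symm, e1.symm⟩
              | exact Or.inr (Or.inl ⟨e1, e2⟩)
              | exact Or.inr (Or.inl ⟨e1.symm, e2⟩)
              | exact Or.inr (Or.inl ⟨e1, e2.symm⟩)
              | exact Or.inr (Or.inl ⟨e1.symm, e2.symm⟩)
              | exact Or.inr (Or.inl ⟨e2, e1⟩)
              | exact Or.inr (Or.inl ⟨e2.symm, e1⟩)
              | exact Or.inr (Or.inl ⟨e2, e1.symm⟩)
              | exact Or.inr (Or.inl ⟨e2.symm, e1.symm⟩)
              | exact Or.inr (Or.inr ⟨e1, e2⟩)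
              | exact Or.inr (Or.inr ⟨e1.symm, e2⟩)
              | exact Or.inr (Or.inr ⟨e1, e2.symm⟩)
              | exact Or.inr (Or.inr ⟨e1.symm, e2.symm⟩)
              | exact Or.inr (Or.inr ⟨e2, e1⟩)
              | exact Or.inr (Or.inr ⟨e2.symm, e1⟩)
              | exact Or.inr (Or.inr ⟨e2, e1.symm⟩)
              | exact Or.inr (Or.inr ⟨e2.symm, e1.symm⟩)))

theorem surr_of_unique_min (b : AffineBasis (Fin 4) ℝ (Fin 3 → ℝ)) (p q : Fin 3 → ℝ)
    (hp : ∀ i, 0 < b.coord i p) (hq : ∀ i, 0 < b.coord i q) (hS : Surr (Set.range b) q) (i : Fin 4)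
    (h : ∀ j, j ≠ i → b.coord i q / b.coord i p < b.coord j q / b.coord j p) :
    Surr ((b '' {i}ᶜ) ∪ {p}) q := by
  intro f hf
  by_contra hcon
  push Not at hcon
  have hG := hcon p (by simp)
  have hF : ∀ j, j ≠ i → f (b j - q) ≤ 0 := fun j hj => hcon _ (Or.inl ⟨j, by simpa using hj, rfl⟩)
  have hFi : 0 < f (b i - q) := by
    obtain ⟨_, ⟨j, rfl⟩, hj⟩ := hS f hf
    by_cases hji : j = i
    · exact hji ▸ hj
    · exact absurd (hF j hji) (not_le.2 hj)
  have hlin : ∀ x, ∑ j, b.coord j x * f (b j - q) = f (x - q) := by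
    intro x
    have e1 := b.linear_combination_coord_eq_self x
    have e2 := b.sum_coord_apply_eq_one x
    calc ∑ j, b.coord j x * f (b j - q)
        = f (∑ j, b.coord j x • b j) - (∑ j, b.coord j x) * f q := by
          simp only [map_sum, map_smul, smul_eq_mul, map_sub, mul_sub, Finset.sum_sub_distrib,
            Finset.sum_mul]
      _ = _ := by rw [e1, e2, one_mul, map_sub]
  have hq0 := hlin q
  have hp0 := hlin p
  rw [sub_self, map_zero] at hq0
  set r := b.coord i q / b.coord i p with hr
  have hr0 : 0 < r := div_pos (hq i) (hp i)
  have hsum : ∑ j, (b.coord j q - r * b.coord j p) * f (b j - q) = - (r * f (p - q)) := by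
    simp only [sub_mul, Finset.sum_sub_distrib, mul_assoc, ← Finset.mul_sum, hq0, hp0]
    ring
  have hri : b.coord i q - r * b.coord i p = 0 := by
    rw [hr, div_mul_cancel₀ _ (hp i).ne', sub_self]
  have hrj : ∀ j, j ≠ i → 0 < b.coord j q - r * b.coord j p := by
    intro j hj
    have := h j hj
    rw [lt_div_iff₀ (hp j)] at this
    linarith
  have hterm : ∀ j ∈ Finset.univ, (b.coord j q - r * b.coord j p) * f (b j - q) ≤ 0 := by
    intro j _
    by_cases hj : j = i
    · rw [hj, hri, zero_mul]
    · exact mul_nonpos_of_nonneg_of_nonpos (hrj j hj).le (hF j hj)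
  have hle := Finset.sum_nonpos hterm
  have hz : ∑ j, (b.coord j q - r * b.coord j p) * f (b j - q) = 0 := by
    apply le_antisymm hle
    rw [hsum]
    nlinarith [mul_nonneg hr0.le (neg_nonneg.2 hG)]
  rw [Finset.sum_eq_zero_iff_of_nonpos hterm] at hz
  have hFz : ∀ j, j ≠ i → f (b j - q) = 0 := by
    intro j hj
    exact (mul_eq_zero.1 (hz j (Finset.mem_univ _))).resolve_left (hrj j hj).ne'
  rw [Finset.sum_eq_single i (fun j _ hj => by rw [hFz j hj, mul_zero]) (by simp)] at hq0
  have := mul_pos (hq i) hFi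
  linarith

theorem tetra_pairing (b : AffineBasis (Fin 4) ℝ (Fin 3 → ℝ)) (p q : Fin 3 → ℝ)
    (hp : Surr (Set.range b) p) (hq : Surr (Set.range b) q)
    (hp0 : ∀ i, 0 < b.coord i p) (hq0 : ∀ i, 0 < b.coord i q)
    (hpq : ∀ i, ¬ Surr ((b '' {i}ᶜ) ∪ {p}) q) (hqp : ∀ i, ¬ Surr ((b '' {i}ᶜ) ∪ {q}) p) :
    Pairing (b.coord 0 q / b.coord 0 p) (b.coord 1 q / b.coord 1 p) (b.coord 2 q / b.coord 2 p)
      (b.coord 3 q / b.coord 3 p) := by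
  apply pairing_of_no_unique (fun i => b.coord i q / b.coord i p)
  · intro i
    by_contra hcon
    push Not at hcon
    exact hpq i (surr_of_unique_min b p q hp0 hq0 hq i hcon)
  · intro i
    by_contra hcon
    push Not at hcon
    refine hqp i (surr_of_unique_min b q p hq0 hp0 hp i fun j hj => ?_)
    have h1 := hcon j hj
    rw [div_lt_div_iff₀ (hp0 j) (hp0 i)] at h1
    rw [div_lt_div_iff₀ (hq0 i) (hq0 j)]
    linarith

theorem tetra_collinear (b : AffineBasis (Fin 4) ℝ (Fin 3 → ℝ)) (I : Set (Fin 3 → ℝ))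
    (hI : ∀ p ∈ I, Surr (Set.range b) p) (hI0 : ∀ p ∈ I, ∀ i, 0 < b.coord i p)
    (hpq : ∀ p ∈ I, ∀ q ∈ I, ∀ i, ¬ Surr ((b '' {i}ᶜ) ∪ {p}) q) : Collinear ℝ I := by
  by_cases hsub : I.Subsingleton
  · rcases hsub.eq_empty_or_singleton with h | ⟨x, h⟩
    · rw [h]; exact collinear_empty ℝ _
    · rw [h]; exact collinear_singleton ℝ _
  obtain ⟨p, hp, q, hq, hne⟩ := Set.not_subsingleton_iff.1 hsub
  rw [collinear_iff_of_mem (p₀ := p) hp]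
  refine ⟨q - p, fun r hr => ?_⟩
  have hpair : ∀ x ∈ I, ∀ y ∈ I, _ := fun x hx y hy =>
    tetra_pairing b x y (hI x hx) (hI y hy) (hI0 x hx) (hI0 y hy) (hpq x hx y hy) (hpq y hy x hx)
  have hp0 := hI0 p hp
  have hq0 := hI0 q hq
  have hr0 := hI0 r hr
  have hs : ∀ x, ∑ i, b.coord i p * (b.coord i x / b.coord i p) = 1 := by
    intro x
    rw [← b.sum_coord_apply_eq_one x]
    exact Finset.sum_congr rfl fun i _ => mul_div_cancel₀ _ (hp0 i).ne'
  have hcan : ∀ i, b.coord i r / b.coord i p / (b.coord i q / b.coord i p)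
      = b.coord i r / b.coord i q := fun i => div_div_div_cancel_right₀ (hp0 i).ne' _ _
  obtain ⟨T, hT⟩ := any_pairing (fun i => b.coord i p) (fun i => b.coord i q / b.coord i p)
    (fun i => b.coord i r / b.coord i p) hp0 (b.sum_coord_apply_eq_one p)
    (fun i => div_pos (hq0 i) (hp0 i)) (fun i => div_pos (hr0 i) (hp0 i)) (hs q) (hs r)
    (by
      by_contra hcon
      push Not at hcon
      apply hne
      rw [← b.linear_combination_coord_eq_self p, ← b.linear_combination_coord_eq_self q]
      refine Finset.sum_congr rfl fun i _ => ?_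
      rw [(div_eq_one_iff_eq (hp0 i).ne').1 (hcon i)])
    (hpair p hp q hq) (hpair p hp r hr) (by
      simp only [hcan]
      exact hpair q hq r hr)
  refine ⟨T, ?_⟩
  have hT' : ∀ i, b.coord i r = b.coord i p + T * (b.coord i q - b.coord i p) := by
    intro i
    have e := hT i
    have hpi := (hp0 i).ne'
    field_simp at e
    linarith
  rw [vadd_eq_add]
  calc r = ∑ i, b.coord i r • b i := (b.linear_combination_coord_eq_self r).symm
    _ = T • (∑ i, b.coord i q • b i - ∑ i, b.coord i p • b i) + ∑ i, b.coord i p • b i := by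
      rw [← Finset.sum_sub_distrib, Finset.smul_sum, ← Finset.sum_add_distrib]
      refine Finset.sum_congr rfl fun i _ => ?_
      rw [hT' i, ← sub_smul, smul_smul, ← add_smul, add_comm]
    _ = _ := by
      rw [b.linear_combination_coord_eq_self p, b.linear_combination_coord_eq_self q]

theorem intrinsicInterior_eq_interior_of_top {P : Set (Fin 3 → ℝ)} (h : affineSpan ℝ P = ⊤) :
    intrinsicInterior ℝ P = interior P := by
  apply Set.Subset.antisymm _ interior_subset_intrinsicInterior
  apply interior_maximal intrinsicInterior_subset
  have ho : IsOpen ((affineSpan ℝ P : Set (Fin 3 → ℝ))) := by rw [h]; exact isOpen_univ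
  exact ho.isOpenMap_subtype_val _ isOpen_interior

theorem castPt_injective {d : ℕ} : Function.Injective (castPt (d := d)) := by
  intro x y h
  funext i
  exact Int.cast_injective (congrFun h i)

/-- Every minimal three-dimensional lattice polytope is either a (minimal) polytope with
exactly one interior lattice point, or a non-hollow tetrahedron whose interior lattice
points lie on a common line. -/
theorem minimal_three_polytope_structure (P : Set (Fin 3 → ℝ))
    (hP : IsLatticePolytope P) (hdim : affineSpan ℝ P = ⊤) (hmin : IsMinimalPolytope P) :
    (relIntLatPts P).ncard = 1 ∨
    (IsLatticeTetrahedron P ∧ (relIntLatPts P).Nonempty ∧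
      Collinear ℝ (castPt '' relIntLatPts P)) := by
  classical
  obtain ⟨V0, hV0, hPV0⟩ := hP
  have hfin : (castPt '' (V0 : Set (Fin 3 → ℤ))).Finite := V0.finite_toSet.image _
  have hconv : Convex ℝ P := by rw [hPV0]; exact convex_convexHull ℝ _
  have hcomp : IsCompact P := by rw [hPV0]; exact hfin.isCompact_convexHull ℝ
  have hext : Set.extremePoints ℝ P ⊆ castPt '' (V0 : Set (Fin 3 → ℤ)) := by
    rw [hPV0]; exact extremePoints_convexHull_subset
  have hextfin : (Set.extremePoints ℝ P).Finite := hfin.subset hext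
  obtain ⟨V, hV⟩ : ∃ V : Finset (Fin 3 → ℝ), (V : Set _) = Set.extremePoints ℝ P :=
    ⟨hextfin.toFinset, by simp⟩
  have hPV : P = convexHull ℝ (V : Set (Fin 3 → ℝ)) := by
    rw [hV]
    have := closure_convexHull_extremePoints hcomp hconv
    rw [(hextfin.isCompact_convexHull ℝ).isClosed.closure_eq] at this
    exact this.symm
  have hint : ∀ x, x ∈ relIntLatPts P ↔ castPt x ∈ interior P := by
    intro x
    rw [← intrinsicInterior_eq_interior_of_top hdim]
    rfl
  obtain ⟨hne, hmin⟩ := hmin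
  have hVP : (V : Set (Fin 3 → ℝ)) ⊆ P := by rw [hV]; exact extremePoints_subset
  have hsurr : ∀ x ∈ relIntLatPts P, Surr (V : Set _) (castPt x) := by
    intro x hx
    have := (hint x).1 hx
    rw [hPV] at this
    exact Surr.of_mem_interior this
  -- minimality in terms of `Surr`
  have hno : ∀ v ∈ V, ∀ x ∈ relIntLatPts P, ∀ S : Set (Fin 3 → ℝ), x ∈ relIntLatPts P →
      (∀ y ∈ S, y ∈ V.erase v ∨ ∃ z ∈ relIntLatPts P, castPt z = y) → ¬ Surr S (castPt x) := by
    intro v hv x hx S _ hS hsu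
    have hvext : v ∈ Set.extremePoints ℝ P := by rw [← hV]; exact hv
    obtain ⟨w, _, rfl⟩ := hext hvext
    have hempty := hmin w hvext
    have hsub : S ⊆ castPt '' (latticePts P \ {w}) := by
      intro y hy
      rcases hS y hy with h | ⟨z, hz, rfl⟩
      · rw [Finset.mem_erase] at h
        have hyext : y ∈ Set.extremePoints ℝ P := by rw [← hV]; exact h.2
        obtain ⟨z, _, rfl⟩ := hext hyext
        refine ⟨z, ⟨hVP h.2, ?_⟩, rfl⟩
        rintro rfl
        exact h.1 rfl
      · have hzi := (hint z).1 hz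
        have hzP : castPt z ∈ P := interior_subset hzi
        refine ⟨z, ⟨hzP, ?_⟩, rfl⟩
        rintro rfl
        exact Set.disjoint_left.1 (disjoint_interior_extremePoints P) hzi hvext
    have hSne : S.Nonempty := by
      obtain ⟨f, hf, _⟩ := exists_kill 0 0
      obtain ⟨y, hy, _⟩ := hsu f hf
      exact ⟨y, hy⟩
    have h1 := (hsu.mono hsub).mem_interior (hSne.mono hsub)
    have h2 : x ∈ relIntLatPts (convexHull ℝ (castPt '' (latticePts P \ {w}))) :=
      interior_subset_intrinsicInterior h1
    rw [hempty] at h2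
    exact h2
  obtain ⟨p, hp⟩ := hne
  by_cases hone : ∀ q ∈ relIntLatPts P, q = p
  · left
    rw [Set.ncard_eq_one]
    exact ⟨p, Set.eq_singleton_iff_unique_mem.2 ⟨hp, hone⟩⟩
  right
  push Not at hone
  obtain ⟨q, hq, hqp⟩ := hone
  have hcard : V.card ≤ 4 := by
    apply card_le_four V (castPt p) (castPt q) (fun h => hqp (castPt_injective h).symm)
      (hsurr p hp) (hsurr q hq)
    · intro v hv
      refine hno v hv p hp _ hp ?_
      rintro y (hy | rfl | rfl)
      · exact Or.inl hy
      · exact Or.inr ⟨p, hp, rfl⟩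
      · exact Or.inr ⟨q, hq, rfl⟩
    · intro v hv
      refine hno v hv q hq _ hq ?_
      rintro y (hy | rfl | rfl)
      · exact Or.inl hy
      · exact Or.inr ⟨q, hq, rfl⟩
      · exact Or.inr ⟨p, hp, rfl⟩
  have hVne : V.Nonempty := by
    obtain ⟨f, hf, _⟩ := exists_kill 0 0
    obtain ⟨y, hy, _⟩ := hsurr p hp f hf
    exact ⟨y, hy⟩
  have hvs : vectorSpan ℝ (V : Set (Fin 3 → ℝ)) = ⊤ := (hsurr p hp).vectorSpan_eq_top hVne
  have hrange : Set.range (fun i : V => (i : Fin 3 → ℝ)) = (V : Set (Fin 3 → ℝ)) := by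
    simp
  have hcard4 : V.card = 4 := by
    apply le_antisymm hcard
    have hc : 1 ≤ V.card := hVne.card_pos
    have := finrank_vectorSpan_range_le ℝ (fun i : V => (i : Fin 3 → ℝ)) (n := V.card - 1)
      (by simp; omega)
    rw [hrange, hvs, finrank_top] at this
    simp at this
    omega
  let e : Fin 4 ≃ V := (V.equivFinOfCardEq hcard4).symm
  let u : Fin 4 → Fin 3 → ℝ := fun i => (e i : Fin 3 → ℝ)
  have hur : Set.range u = (V : Set (Fin 3 → ℝ)) := by
    rw [← hrange]
    exact e.surjective.range_comp (fun i : V => (i : Fin 3 → ℝ))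
  have huinj : Function.Injective u := Subtype.val_injective.comp e.injective
  have huV : ∀ i, u i ∈ V := fun i => (e i).2
  have hind : AffineIndependent ℝ u := by
    rw [affineIndependent_iff_finrank_vectorSpan_eq ℝ u (n := 3) (by simp), hur, hvs, finrank_top]
    simp
  have htop : affineSpan ℝ (Set.range u) = ⊤ := by
    rw [hur]
    exact (AffineSubspace.affineSpan_eq_top_iff_vectorSpan_eq_top_of_nonempty ℝ _ _
      (by simpa using hVne)).2 hvs
  let b : AffineBasis (Fin 4) ℝ (Fin 3 → ℝ) := ⟨u, hind, htop⟩
  have hb : ∀ i, b i = u i := fun _ => rfl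
  have hbr : Set.range b = (V : Set (Fin 3 → ℝ)) := hur
  refine ⟨?_, ⟨p, hp⟩, ?_⟩
  · have hlift : ∀ i, ∃ w : Fin 3 → ℤ, castPt w = u i := by
      intro i
      have : u i ∈ Set.extremePoints ℝ P := by rw [← hV]; exact huV i
      obtain ⟨w, _, hw⟩ := hext this
      exact ⟨w, hw⟩
    choose w hw using hlift
    have hwu : (fun i => castPt (w i)) = u := funext hw
    refine ⟨w, ?_, ?_⟩
    · rw [hwu]; exact hind
    · rw [hwu, hur]; exact hPV
  · apply tetra_collinear b
    · rintro _ ⟨x, hx, rfl⟩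
      rw [hbr]
      exact hsurr x hx
    · rintro _ ⟨x, hx, rfl⟩
      have h1 := (hint x).1 hx
      rw [hPV, ← hbr, b.interior_convexHull] at h1
      exact h1
    · rintro _ ⟨x, hx, rfl⟩ _ ⟨y, hy, rfl⟩ i
      refine hno (u i) (huV i) y hy _ hy ?_
      rintro z (⟨j, hj, rfl⟩ | rfl)
      · left
        rw [Finset.mem_erase]
        exact ⟨fun h => hj (huinj h), huV j⟩
      · exact Or.inr ⟨x, hx, rfl⟩
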